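/- For every ordinal α, V_{α+1} is a natural model of Bernays' theory B_1 (i.e., (V_{α+1}, ∈) ⊨ B_1) if and only if α is a Π¹_∞-indescribable cardinal. -/

import Mathlib

universe u

/-- Formulas of the first-order language of set theory (one binary relation `∈`),
with named variables. -/
inductive FOF : Type
  | eq (i j : ℕ)
  | mem (i j : ℕ)
  | not (φ : FOF)
  | and (φ ψ : FOF)
  | or (φ ψ : FOF)
  | all (i : ℕ) (φ : FOF)
  | ex (i : ℕ) (φ : FOF)

/-- Satisfaction of a first-order formula in the structure with universe the elements of
`M` satisfying `D`, with membership interpreted by `E` (so `FOF.Eval E D φ ρ` is the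
relativization of `φ` to `D`). -/
def FOF.Eval {M : Type*} (E : M → M → Prop) (D : M → Prop) : FOF → (ℕ → M) → Prop
  | .eq i j, ρ => ρ i = ρ j
  | .mem i j, ρ => E (ρ i) (ρ j)
  | .not φ, ρ => ¬ FOF.Eval E D φ ρ
  | .and φ ψ, ρ => FOF.Eval E D φ ρ ∧ FOF.Eval E D ψ ρ
  | .or φ ψ, ρ => FOF.Eval E D φ ρ ∨ FOF.Eval E D ψ ρ
  | .all i φ, ρ => ∀ x, D x → FOF.Eval E D φ (Function.update ρ i x)
  | .ex i φ, ρ => ∃ x, D x ∧ FOF.Eval E D φ (Function.update ρ i x)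

/-- The free variables of a first-order formula. -/
def FOF.free : FOF → Set ℕ
  | .eq i j => {i, j}
  | .mem i j => {i, j}
  | .not φ => φ.free
  | .and φ ψ => φ.free ∪ ψ.free
  | .or φ ψ => φ.free ∪ ψ.free
  | .all i φ => φ.free \ {i}
  | .ex i φ => φ.free \ {i}
section BernaysB1

variable {M : Type u} (E : M → M → Prop)

/-- In Bernays' class theory the objects of the domain of discourse are classes; a class
is a set iff it is a member of some class. -/
def IsSetB1 (x : M) : Prop := ∃ c, E x c

/-- `(M, E)` is a model of Bernays' theory `B₁`: extensionality, class specification,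
subsets, the Bernays reflection schema `φ(A) → ∃u (u transitive set ∧ φ^{P(u)}(A ∩ u))`,
foundation, and choice for sets. -/
def SatB1 : Prop :=
  -- (A1) extensionality
  (∀ A B : M, (∀ x, E x A ↔ E x B) → A = B) ∧
  -- (A2) class specification (for any formula φ, with parameters)
  (∀ (φ : FOF) (ρ : ℕ → M), ∃ A : M, ∀ x,
      E x A ↔ (FOF.Eval E (fun _ => True) φ (Function.update ρ 0 x) ∧ IsSetB1 E x)) ∧
  -- (A3) subsets
  (∀ A B : M, IsSetB1 E A → (∀ x, E x B → E x A) → IsSetB1 E B) ∧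
  -- (A4) reflection: for every formula φ(x) with one free variable,
  --      φ(A) → ∃u (u a transitive set ∧ φ^{P(u)}(A ∩ u))
  (∀ φ : FOF, φ.free ⊆ {0} → ∀ ρ : ℕ → M,
      FOF.Eval E (fun _ => True) φ ρ →
      ∃ u b : M, IsSetB1 E u ∧ (∀ y, E y u → ∀ z, E z y → E z u) ∧
        (∀ z, E z b ↔ (E z (ρ 0) ∧ E z u)) ∧
        FOF.Eval E (fun x => ∀ z, E z x → E z u) φ (Function.update ρ 0 b)) ∧
  -- (A5) foundation
  (∀ A : M, (∃ x, E x A) → ∃ x, E x A ∧ ∀ z, ¬ (E z x ∧ E z A)) ∧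
  -- (A6) choice for sets
  (∀ x : M, IsSetB1 E x →
    (∀ y y', E y x → E y' x → y ≠ y' → ¬ ∃ z, E z y ∧ E z y') →
    ∃ x' : M, ∀ y, E y x → (∃ z, E z y) → ∃! z, E z y ∧ E z x')

end BernaysB1

/-- `V_α` as a collection of `ZFSet`s. -/
def Vset (α : Ordinal) : Set ZFSet := {x | x.rank < α}

/-- Formulas of the second-order language of set theory with a distinguished second-order
constant `A` (lower-case variables are first order, upper-case second order). -/
inductive SOF : Type
  | mem (i j : ℕ)
  | eq (i j : ℕ)
  | Mem (i J : ℕ)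
  | inA (i : ℕ)
  | not (φ : SOF)
  | and (φ ψ : SOF)
  | or (φ ψ : SOF)
  | fall (i : ℕ) (φ : SOF)
  | fex (i : ℕ) (φ : SOF)
  | Fall (J : ℕ) (φ : SOF)
  | Fex (J : ℕ) (φ : SOF)

/-- Satisfaction of a second-order formula in the structure `(D, ∈, A)`, first-order
variables ranging over `D` and second-order ones over the subsets of `D`. -/
def SOF.Eval (D : Set ZFSet) (A : Set ZFSet) :
    SOF → (ℕ → ZFSet) → (ℕ → Set ZFSet) → Prop
  | .mem i j, ρ, _ => ρ i ∈ ρ j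
  | .eq i j, ρ, _ => ρ i = ρ j
  | .Mem i J, ρ, σ => ρ i ∈ σ J
  | .inA i, ρ, _ => ρ i ∈ A
  | .not φ, ρ, σ => ¬ SOF.Eval D A φ ρ σ
  | .and φ ψ, ρ, σ => SOF.Eval D A φ ρ σ ∧ SOF.Eval D A ψ ρ σ
  | .or φ ψ, ρ, σ => SOF.Eval D A φ ρ σ ∨ SOF.Eval D A ψ ρ σ
  | .fall i φ, ρ, σ => ∀ x ∈ D, SOF.Eval D A φ (Function.update ρ i x) σ
  | .fex i φ, ρ, σ => ∃ x ∈ D, SOF.Eval D A φ (Function.update ρ i x) σ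
  | .Fall J φ, ρ, σ => ∀ X : Set ZFSet, X ⊆ D → SOF.Eval D A φ ρ (Function.update σ J X)
  | .Fex J φ, ρ, σ => ∃ X : Set ZFSet, X ⊆ D ∧ SOF.Eval D A φ ρ (Function.update σ J X)

/-- Free first-order variables. -/
def SOF.foFree : SOF → Set ℕ
  | .mem i j => {i, j}
  | .eq i j => {i, j}
  | .Mem i _ => {i}
  | .inA i => {i}
  | .not φ => φ.foFree
  | .and φ ψ => φ.foFree ∪ ψ.foFree
  | .or φ ψ => φ.foFree ∪ ψ.foFree
  | .fall i φ => φ.foFree \ {i}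
  | .fex i φ => φ.foFree \ {i}
  | .Fall _ φ => φ.foFree
  | .Fex _ φ => φ.foFree

/-- Free second-order variables. -/
def SOF.soFree : SOF → Set ℕ
  | .mem _ _ => ∅
  | .eq _ _ => ∅
  | .Mem _ J => {J}
  | .inA _ => ∅
  | .not φ => φ.soFree
  | .and φ ψ => φ.soFree ∪ ψ.soFree
  | .or φ ψ => φ.soFree ∪ ψ.soFree
  | .fall _ φ => φ.soFree
  | .fex _ φ => φ.soFree
  | .Fall J φ => φ.soFree \ {J}
  | .Fex J φ => φ.soFree \ {J}

/-- `φ` contains no second-order quantifiers. -/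
def SOF.NoSOQ : SOF → Prop
  | .mem _ _ => True
  | .eq _ _ => True
  | .Mem _ _ => True
  | .inA _ => True
  | .not φ => φ.NoSOQ
  | .and φ ψ => φ.NoSOQ ∧ ψ.NoSOQ
  | .or φ ψ => φ.NoSOQ ∧ ψ.NoSOQ
  | .fall _ φ => φ.NoSOQ
  | .fex _ φ => φ.NoSOQ
  | .Fall _ _ => False
  | .Fex _ _ => False

mutual
  /-- `Π¹ₙ` formulas: `n` alternating blocks of second-order quantifiers, beginning with a
  universal block, followed by a first-order matrix. -/
  inductive IsPiSO : ℕ → SOF → Prop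
    | base (n : ℕ) (φ : SOF) : φ.NoSOQ → IsPiSO n φ
    | univ (n J : ℕ) (φ : SOF) : IsPiSO (n+1) φ → IsPiSO (n+1) (.Fall J φ)
    | ofSig (n : ℕ) (φ : SOF) : IsSigSO n φ → IsPiSO (n+1) φ

  /-- `Σ¹ₙ` formulas. -/
  inductive IsSigSO : ℕ → SOF → Prop
    | base (n : ℕ) (φ : SOF) : φ.NoSOQ → IsSigSO n φ
    | exis (n J : ℕ) (φ : SOF) : IsSigSO (n+1) φ → IsSigSO (n+1) (.Fex J φ)
    | ofPi (n : ℕ) (φ : SOF) : IsPiSO n φ → IsSigSO (n+1) φ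
end

/-- `α` is `Π¹ₙ`-indescribable: for every `Π¹ₙ` sentence `φ` and every `A ⊆ V_α`, if
`(V_α, ∈, A) ⊨ φ` then `(V_β, ∈, A ∩ V_β) ⊨ φ` for some `β < α`. -/
def PiIndescribable (n : ℕ) (α : Ordinal) : Prop :=
  ∀ φ : SOF, IsPiSO n φ → φ.foFree = ∅ → φ.soFree = ∅ →
    ∀ A : Set ZFSet, A ⊆ Vset α →
      (∀ ρ σ, SOF.Eval (Vset α) A φ ρ σ) →
      ∃ β < α, ∀ ρ σ, SOF.Eval (Vset β) (A ∩ Vset β) φ ρ σ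

/-- A totally indescribable cardinal: `Π¹ₙ`-indescribable for all `n < ω`. -/
def TotallyIndescribable (α : Ordinal) : Prop :=
  (∃ c : Cardinal, c.ord = α) ∧ ∀ n : ℕ, PiIndescribable n α

section Formulas

theorem FOF.eval_congr {M : Type*} {E : M → M → Prop} {D : M → Prop} (φ : FOF) {ρ ρ' : ℕ → M}
    (h : ∀ i ∈ φ.free, ρ i = ρ' i) : φ.Eval E D ρ ↔ φ.Eval E D ρ' := by
  induction φ generalizing ρ ρ' with
  | eq i j => simp [FOF.Eval, h i (by simp [FOF.free]), h j (by simp [FOF.free])]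
  | mem i j => simp [FOF.Eval, h i (by simp [FOF.free]), h j (by simp [FOF.free])]
  | not φ ih => exact not_congr (ih h)
  | and φ ψ ih ih' =>
    exact and_congr (ih fun i hi => h i (Or.inl hi)) (ih' fun i hi => h i (Or.inr hi))
  | or φ ψ ih ih' =>
    exact or_congr (ih fun i hi => h i (Or.inl hi)) (ih' fun i hi => h i (Or.inr hi))
  | all i φ ih =>
    refine forall_congr' fun x => imp_congr_right fun _ => ih fun k hk => ?_
    by_cases hki : k = i
    · simp [hki]
    · simpa [hki] using h k ⟨hk, hki⟩
  | ex i φ ih =>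
    refine exists_congr fun x => and_congr_right fun _ => ih fun k hk => ?_
    by_cases hki : k = i
    · simp [hki]
    · simpa [hki] using h k ⟨hk, hki⟩

/-- Satisfaction is preserved by an embedding that maps the first domain onto the second. -/
theorem FOF.eval_map {M N : Type*} {E D} {E' D'} {f : M → N} (hf : f.Injective)
    (hE : ∀ x y, E x y ↔ E' (f x) (f y)) (hD : ∀ y, D' y ↔ ∃ x, D x ∧ f x = y)
    (φ : FOF) (ρ : ℕ → M) : φ.Eval E D ρ ↔ φ.Eval E' D' (f ∘ ρ) := by
  induction φ generalizing ρ with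
  | eq i j => exact hf.eq_iff.symm
  | mem i j => exact hE _ _
  | not φ ih => exact not_congr (ih ρ)
  | and φ ψ ih ih' => exact and_congr (ih ρ) (ih' ρ)
  | or φ ψ ih ih' => exact or_congr (ih ρ) (ih' ρ)
  | all i φ ih => simp [FOF.Eval, ih, hD, Function.comp_update]
  | ex i φ ih => simp [FOF.Eval, ih, hD, Function.comp_update]

theorem SOF.eval_congr {D A : Set ZFSet} (φ : SOF) {ρ ρ' : ℕ → ZFSet} {σ σ' : ℕ → Set ZFSet}
    (hρ : ∀ i ∈ φ.foFree, ρ i = ρ' i) (hσ : ∀ J ∈ φ.soFree, σ J = σ' J) :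
    φ.Eval D A ρ σ ↔ φ.Eval D A ρ' σ' := by
  induction φ generalizing ρ ρ' σ σ' with
  | mem i j => simp [SOF.Eval, hρ i (by simp [SOF.foFree]), hρ j (by simp [SOF.foFree])]
  | eq i j => simp [SOF.Eval, hρ i (by simp [SOF.foFree]), hρ j (by simp [SOF.foFree])]
  | Mem i J => simp [SOF.Eval, hρ i (by simp [SOF.foFree]), hσ J (by simp [SOF.soFree])]
  | inA i => simp [SOF.Eval, hρ i (by simp [SOF.foFree])]
  | not φ ih => exact not_congr (ih hρ hσ)
  | and φ ψ ih ih' =>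
    exact and_congr (ih (fun i hi => hρ i (Or.inl hi)) fun i hi => hσ i (Or.inl hi))
      (ih' (fun i hi => hρ i (Or.inr hi)) fun i hi => hσ i (Or.inr hi))
  | or φ ψ ih ih' =>
    exact or_congr (ih (fun i hi => hρ i (Or.inl hi)) fun i hi => hσ i (Or.inl hi))
      (ih' (fun i hi => hρ i (Or.inr hi)) fun i hi => hσ i (Or.inr hi))
  | fall i φ ih =>
    refine forall_congr' fun x => imp_congr_right fun _ => ih (fun k hk => ?_) hσ
    by_cases hki : k = i
    · simp [hki]
    · simpa [hki] using hρ k ⟨hk, hki⟩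
  | fex i φ ih =>
    refine exists_congr fun x => and_congr_right fun _ => ih (fun k hk => ?_) hσ
    by_cases hki : k = i
    · simp [hki]
    · simpa [hki] using hρ k ⟨hk, hki⟩
  | Fall J φ ih =>
    refine forall_congr' fun x => imp_congr_right fun _ => ih hρ fun k hk => ?_
    by_cases hki : k = J
    · simp [hki]
    · simpa [hki] using hσ k ⟨hk, hki⟩
  | Fex J φ ih =>
    refine exists_congr fun x => and_congr_right fun _ => ih hρ fun k hk => ?_
    by_cases hki : k = J
    · simp [hki]
    · simpa [hki] using hσ k ⟨hk, hki⟩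

theorem SOF.finite_soFree (φ : SOF) : φ.soFree.Finite := by
  induction φ with
  | mem | eq | inA => exact Set.finite_empty
  | Mem => exact Set.finite_singleton _
  | not _ ih => exact ih
  | and _ _ ih ih' => exact ih.union ih'
  | or _ _ ih ih' => exact ih.union ih'
  | fall _ _ ih => exact ih
  | fex _ _ ih => exact ih
  | Fall _ _ ih => exact ih.sdiff
  | Fex _ _ ih => exact ih.sdiff

theorem SOF.exists_soFree_lt (φ : SOF) : ∃ B, ∀ J ∈ φ.soFree, J < B := by
  obtain ⟨B, hB⟩ := φ.finite_soFree.bddAbove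
  exact ⟨B + 1, fun J hJ => Nat.lt_succ_of_le (hB hJ)⟩

/-- Membership between classes: `Y` has an element whose extension is `X`. -/
def ClassMem (X Y : Set ZFSet) : Prop := ∃ y ∈ Y, (y : Set ZFSet) = X

@[simp]
theorem classMem_coe (x : ZFSet) (Y : Set ZFSet) : ClassMem x Y ↔ x ∈ Y := by
  simp [ClassMem]

/-- The translation of second-order formulas over `D` into first-order formulas over the subsets
of `D`; variable `0` stands for the constant `A`, variables `3 * i + 1` and `3 * J + 2` stand for
the first-order variable `i` and the second-order variable `J`. -/
def SOF.toFOF : SOF → FOF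
  | .mem i j => .mem (3 * i + 1) (3 * j + 1)
  | .eq i j => .eq (3 * i + 1) (3 * j + 1)
  | .Mem i J => .mem (3 * i + 1) (3 * J + 2)
  | .inA i => .mem (3 * i + 1) 0
  | .not φ => .not φ.toFOF
  | .and φ ψ => .and φ.toFOF ψ.toFOF
  | .or φ ψ => .or φ.toFOF ψ.toFOF
  | .fall i φ => .all (3 * i + 1) (.or (.not (.ex 3 (.mem (3 * i + 1) 3))) φ.toFOF)
  | .fex i φ => .ex (3 * i + 1) (.and (.ex 3 (.mem (3 * i + 1) 3)) φ.toFOF)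
  | .Fall J φ => .all (3 * J + 2) φ.toFOF
  | .Fex J φ => .ex (3 * J + 2) φ.toFOF

theorem SOF.eval_toFOF {D A : Set ZFSet} (hD : ∀ x ∈ D, (x : Set ZFSet) ⊆ D) (φ : SOF)
    {ρ : ℕ → ZFSet} {σ τ : ℕ → Set ZFSet} (h0 : τ 0 = A)
    (hρ : ∀ i ∈ φ.foFree, τ (3 * i + 1) = ρ i) (hσ : ∀ J ∈ φ.soFree, τ (3 * J + 2) = σ J) :
    φ.Eval D A ρ σ ↔ φ.toFOF.Eval ClassMem (· ⊆ D) τ := by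
  have isSet (X : Set ZFSet) : (∃ C ⊆ D, ClassMem X C) ↔ ∃ x ∈ D, (x : Set ZFSet) = X :=
    ⟨fun ⟨C, hC, x, hx, e⟩ => ⟨x, hC hx, e⟩, fun h => ⟨D, subset_rfl, h⟩⟩
  have updFO {i : ℕ} {x : ZFSet} {S : Set ℕ} {ρ : ℕ → ZFSet} {τ : ℕ → Set ZFSet}
      (h : ∀ k ∈ S \ {i}, τ (3 * k + 1) = ρ k) : ∀ k ∈ S,
      Function.update τ (3 * i + 1) x (3 * k + 1) = Function.update ρ i x k := by
    intro k hk
    by_cases hki : k = i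
    · simp [hki]
    · simpa [hki] using h k ⟨hk, hki⟩
  have updSO {i : ℕ} {x : Set ZFSet} {S : Set ℕ} {σ τ : ℕ → Set ZFSet}
      (h : ∀ k ∈ S \ {i}, τ (3 * k + 2) = σ k) : ∀ k ∈ S,
      Function.update τ (3 * i + 2) x (3 * k + 2) = Function.update σ i x k := by
    intro k hk
    by_cases hki : k = i
    · simp [hki]
    · simpa [hki] using h k ⟨hk, hki⟩
  have updFO' {i : ℕ} {x : Set ZFSet} {S : Set ℕ} {σ τ : ℕ → Set ZFSet}
      (h : ∀ k ∈ S, τ (3 * k + 2) = σ k) : ∀ k ∈ S,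
      Function.update τ (3 * i + 1) x (3 * k + 2) = σ k := by
    intro k hk
    rw [Function.update_of_ne (by omega), h k hk]
  have updSO' {i : ℕ} {x : Set ZFSet} {S : Set ℕ} {ρ : ℕ → ZFSet} {τ : ℕ → Set ZFSet}
      (h : ∀ k ∈ S, τ (3 * k + 1) = ρ k) : ∀ k ∈ S,
      Function.update τ (3 * i + 2) x (3 * k + 1) = ρ k := by
    intro k hk
    rw [Function.update_of_ne (by omega), h k hk]
  have ne3 (i : ℕ) : 3 * i + 1 ≠ 3 := by omega
  induction φ generalizing ρ σ τ with
  | mem i j =>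
    simp [SOF.Eval, SOF.toFOF, FOF.Eval, hρ i (by simp [SOF.foFree]), hρ j (by simp [SOF.foFree])]
  | eq i j =>
    simp [SOF.Eval, SOF.toFOF, FOF.Eval, hρ i (by simp [SOF.foFree]), hρ j (by simp [SOF.foFree])]
  | Mem i J =>
    simp [SOF.Eval, SOF.toFOF, FOF.Eval, hρ i (by simp [SOF.foFree]), hσ J (by simp [SOF.soFree])]
  | inA i => simp [SOF.Eval, SOF.toFOF, FOF.Eval, hρ i (by simp [SOF.foFree]), h0]
  | not φ ih => exact not_congr (ih h0 hρ hσ)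
  | and φ ψ ih ih' =>
    exact and_congr (ih h0 (fun i hi => hρ i (Or.inl hi)) fun i hi => hσ i (Or.inl hi))
      (ih' h0 (fun i hi => hρ i (Or.inr hi)) fun i hi => hσ i (Or.inr hi))
  | or φ ψ ih ih' =>
    exact or_congr (ih h0 (fun i hi => hρ i (Or.inl hi)) fun i hi => hσ i (Or.inl hi))
      (ih' h0 (fun i hi => hρ i (Or.inr hi)) fun i hi => hσ i (Or.inr hi))
  | fall i φ ih =>
    have key (x : ZFSet) := ih (ρ := Function.update ρ i x) (σ := σ)
      (τ := Function.update τ (3 * i + 1) x) (by simpa using h0) (updFO hρ) (updFO' hσ)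
    simp only [SOF.Eval, SOF.toFOF, FOF.Eval, key, Function.update_self,
      Function.update_of_ne (ne3 i), isSet, ← imp_iff_not_or]
    constructor
    · rintro h _ - ⟨x, hx, rfl⟩
      exact h x hx
    · exact fun h x hx => h x (hD x hx) ⟨x, hx, rfl⟩
  | fex i φ ih =>
    have key (x : ZFSet) := ih (ρ := Function.update ρ i x) (σ := σ)
      (τ := Function.update τ (3 * i + 1) x) (by simpa using h0) (updFO hρ) (updFO' hσ)
    simp only [SOF.Eval, SOF.toFOF, FOF.Eval, key, Function.update_self,
      Function.update_of_ne (ne3 i), isSet]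
    constructor
    · rintro ⟨x, hx, h⟩
      exact ⟨x, hD x hx, ⟨x, hx, rfl⟩, h⟩
    · rintro ⟨_, -, ⟨x, hx, rfl⟩, h⟩
      exact ⟨x, hx, h⟩
  | Fall J φ ih =>
    exact forall_congr' fun X => imp_congr_right fun _ =>
      ih (by simpa using h0) (updSO' hρ) (updSO hσ)
  | Fex J φ ih =>
    exact exists_congr fun X => and_congr_right fun _ =>
      ih (by simpa using h0) (updSO' hρ) (updSO hσ)

theorem SOF.free_toFOF (φ : SOF) {k : ℕ} (hk : k ∈ φ.toFOF.free) :
    k = 0 ∨ (∃ i ∈ φ.foFree, k = 3 * i + 1) ∨ ∃ J ∈ φ.soFree, k = 3 * J + 2 := by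
  induction φ with
  | mem | eq | Mem | inA =>
    simp only [SOF.toFOF, FOF.free, SOF.foFree, SOF.soFree, Set.mem_insert_iff,
      Set.mem_singleton_iff] at *
    grind
  | not φ ih => exact ih hk
  | and φ ψ ih ih' | or φ ψ ih ih' =>
    simp only [SOF.foFree, SOF.soFree, Set.mem_union]
    rcases hk with hk | hk
    · have := ih hk
      grind
    · have := ih' hk
      grind
  | fall i φ ih | fex i φ ih | Fall i φ ih | Fex i φ ih =>
    simp only [SOF.toFOF, FOF.free, SOF.foFree, SOF.soFree, Set.mem_sdiff, Set.mem_union,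
      Set.mem_insert_iff, Set.mem_singleton_iff] at *
    grind

end Formulas

section Prenex

/-- `SOF.quantified l M` is `M` preceded by the second-order quantifiers listed in `l`, where `true`
marks a universal one. -/
def SOF.quantified : List (Bool × ℕ) → SOF → SOF
  | [], M => M
  | (true, J) :: l, M => .Fall J (SOF.quantified l M)
  | (false, J) :: l, M => .Fex J (SOF.quantified l M)

theorem SOF.quantified_append (l l' : List (Bool × ℕ)) (M : SOF) :
    SOF.quantified (l ++ l') M = SOF.quantified l (SOF.quantified l' M) := by
  induction l with
  | nil => rfl
  | cons q l ih => obtain ⟨_ | _, J⟩ := q <;> simp [SOF.quantified, ih]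

theorem SOF.isPiSO_quantified (l : List (Bool × ℕ)) {M : SOF} (hM : M.NoSOQ) :
    IsPiSO (l.length + 1) (SOF.quantified l M) ∧ IsSigSO (l.length + 1) (SOF.quantified l M) := by
  induction l with
  | nil => exact ⟨.base _ _ hM, .base _ _ hM⟩
  | cons q l ih =>
    obtain ⟨_ | _, J⟩ := q
    · exact ⟨.ofSig _ _ (.exis _ _ _ ih.2), .exis _ _ _ (.ofPi _ _ ih.1)⟩
    · exact ⟨.univ _ _ _ (.ofSig _ _ ih.2), .ofPi _ _ (.univ _ _ _ ih.1)⟩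

theorem SOF.foFree_quantified (l : List (Bool × ℕ)) (M : SOF) :
    (SOF.quantified l M).foFree = M.foFree := by
  induction l with
  | nil => rfl
  | cons q l ih => obtain ⟨_ | _, J⟩ := q <;> exact ih

theorem SOF.mem_soFree_quantified {l : List (Bool × ℕ)} {M : SOF} {J : ℕ} :
    J ∈ (SOF.quantified l M).soFree ↔ J ∈ M.soFree ∧ ∀ q ∈ l, q.2 ≠ J := by
  induction l with
  | nil => simp [SOF.quantified]
  | cons q l ih =>
    obtain ⟨_ | _, J⟩ := q <;> simp [SOF.quantified, SOF.soFree, ih] <;> grind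

theorem update_subset {D X : Set ZFSet} {σ : ℕ → Set ZFSet} (hσ : ∀ i, σ i ⊆ D) (hX : X ⊆ D)
    (J i : ℕ) : Function.update σ J X i ⊆ D := by
  by_cases h : i = J
  · simpa [h]
  · simpa [h] using hσ i

variable {D A : Set ZFSet}

theorem SOF.eval_quantified_and {l : List (Bool × ℕ)} {X M : SOF} {Y : (ℕ → Set ZFSet) → Prop}
    {ρ : ℕ → ZFSet}
    (hX : ∀ σ, (∀ i, σ i ⊆ D) → (X.Eval D A ρ σ ↔ M.Eval D A ρ σ ∧ Y σ))
    (hY : ∀ q ∈ l, ∀ σ Z, Y (Function.update σ q.2 Z) ↔ Y σ) {σ : ℕ → Set ZFSet}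
    (hσ : ∀ i, σ i ⊆ D) :
    (SOF.quantified l X).Eval D A ρ σ ↔ (SOF.quantified l M).Eval D A ρ σ ∧ Y σ := by
  induction l generalizing σ with
  | nil => exact hX σ hσ
  | cons q l ih =>
    have ih' {J : ℕ} (Z) (hZ : Z ⊆ D) := ih (fun q hq => hY q (List.mem_cons_of_mem _ hq))
      (update_subset hσ hZ J)
    have hY' := hY q List.mem_cons_self σ
    obtain ⟨_ | _, J⟩ := q
    · constructor
      · rintro ⟨Z, hZ, h⟩
        have := (ih' Z hZ).1 h
        exact ⟨⟨Z, hZ, this.1⟩, (hY' Z).1 this.2⟩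
      · rintro ⟨⟨Z, hZ, h⟩, h'⟩
        exact ⟨Z, hZ, (ih' Z hZ).2 ⟨h, (hY' Z).2 h'⟩⟩
    · constructor
      · intro h
        have (Z) (hZ : Z ⊆ D) := (ih' Z hZ).1 (h Z hZ)
        exact ⟨fun Z hZ => (this Z hZ).1, (hY' ∅).1 (this ∅ (Set.empty_subset _)).2⟩
      · rintro ⟨h, h'⟩ Z hZ
        exact (ih' Z hZ).2 ⟨h Z hZ, (hY' Z).2 h'⟩

theorem SOF.eval_quantified_const {l : List (Bool × ℕ)} {M : SOF} {p : Prop} {ρ : ℕ → ZFSet}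
    (hM : ∀ σ, (∀ i, σ i ⊆ D) → (M.Eval D A ρ σ ↔ p)) {σ : ℕ → Set ZFSet} (hσ : ∀ i, σ i ⊆ D) :
    (SOF.quantified l M).Eval D A ρ σ ↔ p := by
  induction l generalizing σ with
  | nil => exact hM σ hσ
  | cons q l ih =>
    have ih' {J : ℕ} (Z) (hZ : Z ⊆ D) := ih (update_subset hσ hZ J)
    obtain ⟨_ | _, J⟩ := q
    · exact ⟨fun ⟨Z, hZ, h⟩ => (ih' Z hZ).1 h,
        fun h => ⟨∅, Set.empty_subset _, (ih' ∅ (Set.empty_subset _)).2 h⟩⟩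
    · exact ⟨fun h => (ih' ∅ (Set.empty_subset _)).1 (h ∅ (Set.empty_subset _)),
        fun h Z hZ => (ih' Z hZ).2 h⟩

theorem SOF.eval_quantified_not (l : List (Bool × ℕ)) (M : SOF) (ρ : ℕ → ZFSet)
    (σ : ℕ → Set ZFSet) :
    (SOF.quantified (l.map fun q => (!q.1, q.2)) M.not).Eval D A ρ σ ↔
      ¬ (SOF.quantified l M).Eval D A ρ σ := by
  induction l generalizing σ with
  | nil => rfl
  | cons q l ih => obtain ⟨_ | _, J⟩ := q <;> simp [SOF.quantified, SOF.Eval, ih]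

/-- A property of finitely many subsets of `D` that can be expressed by prenex formulas, uniformly
in transitive `D` and `A ⊆ D`, with arbitrary free variables and with arbitrarily large bound
second-order variables. -/
def PrenexDefinable (P : Set ZFSet → Set ZFSet → (ℕ → Set ZFSet) → Prop) : Prop :=
  ∃ N, (∀ D A σ σ', (∀ i < N, σ i = σ' i) → (P D A σ ↔ P D A σ')) ∧
    ∀ (r : ℕ → ℕ) (k : ℕ), ∃ (l : List (Bool × ℕ)) (M : SOF), M.NoSOQ ∧ M.foFree = ∅ ∧
      (∀ q ∈ l, k ≤ q.2) ∧ ∀ (D A : Set ZFSet) (ρ : ℕ → ZFSet) (σ : ℕ → Set ZFSet),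
        (∀ x ∈ D, (x : Set ZFSet) ⊆ D) → A ⊆ D → (∀ i, σ i ⊆ D) →
          ((SOF.quantified l M).Eval D A ρ σ ↔ P D A (σ ∘ r))

namespace PrenexDefinable

variable {P Q : Set ZFSet → Set ZFSet → (ℕ → Set ZFSet) → Prop}

theorem congr (hP : PrenexDefinable P) (h : ∀ D A σ, P D A σ ↔ Q D A σ) :
    PrenexDefinable Q := by
  have : P = Q := by ext; exact h ..
  exact this ▸ hP

theorem not (hP : PrenexDefinable P) : PrenexDefinable fun D A σ => ¬ P D A σ := by
  obtain ⟨N, hN, hP⟩ := hP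
  refine ⟨N, fun D A σ σ' h => not_congr (hN D A σ σ' h), fun r k => ?_⟩
  obtain ⟨l, M, hM, hM', hl, h⟩ := hP r k
  refine ⟨l.map fun q => (!q.1, q.2), M.not, hM, hM', ?_, fun D A ρ σ hD hA hσ => ?_⟩
  · simpa [and_comm] using hl
  rw [SOF.eval_quantified_not, h D A ρ σ hD hA hσ]

theorem and (hP : PrenexDefinable P) (hQ : PrenexDefinable Q) :
    PrenexDefinable fun D A σ => P D A σ ∧ Q D A σ := by
  obtain ⟨N, hN, hP⟩ := hP
  obtain ⟨N', hN', hQ⟩ := hQ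
  refine ⟨max N N', fun D A σ σ' h => and_congr
    (hN D A σ σ' fun i hi => h i (lt_max_of_lt_left hi))
    (hN' D A σ σ' fun i hi => h i (lt_max_of_lt_right hi)), fun r k => ?_⟩
  obtain ⟨R, hR⟩ : ∃ R, ∀ i < N', r i < R :=
    ⟨(Finset.range N').sup r + 1, fun i hi =>
      Nat.lt_succ_of_le (Finset.le_sup (f := r) (Finset.mem_range.2 hi))⟩
  obtain ⟨l, M, hM, hM', hl, h⟩ := hP r (max k R)
  obtain ⟨B, hB⟩ := M.exists_soFree_lt
  obtain ⟨l', M', hM₁, hM₁', hl', h'⟩ := hQ r (max k B)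
  refine ⟨l ++ l', M'.and M, ⟨hM₁, hM⟩, ?_, ?_, fun D A ρ σ hD hA hσ => ?_⟩
  · simp [SOF.foFree, hM', hM₁']
  · intro q hq
    rcases List.mem_append.1 hq with hq | hq
    · exact (le_max_left _ _).trans (hl q hq)
    · exact (le_max_left _ _).trans (hl' q hq)
  · simp only [SOF.quantified_append, ← h D A ρ σ hD hA hσ]
    refine SOF.eval_quantified_and (Y := fun σ => Q D A (σ ∘ r)) (fun σ hσ => ?_)
      (fun q hq σ Z => hN' _ _ _ _ fun i hi => ?_) hσ
    · rw [← h' D A ρ σ hD hA hσ, and_comm]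
      refine SOF.eval_quantified_and (Y := M.Eval D A ρ) (fun σ _ => Iff.rfl)
        (fun q hq σ Z => M.eval_congr (fun _ _ => rfl) fun J hJ => ?_) hσ
      have := hB J hJ
      have := hl' q hq
      exact Function.update_of_ne (by omega) _ _
    · have := hR i hi
      have := hl q hq
      exact Function.update_of_ne (by omega) _ _

theorem all (i : ℕ) (hP : PrenexDefinable P) :
    PrenexDefinable fun D A σ => ∀ X ⊆ D, P D A (Function.update σ i X) := by
  obtain ⟨N, hN, hP⟩ := hP
  refine ⟨N, fun D A σ σ' h => forall_congr' fun X => imp_congr_right fun _ =>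
    hN _ _ _ _ fun j hj => ?_, fun r k => ?_⟩
  · by_cases hji : j = i
    · simp [hji]
    · simpa [hji] using h j hj
  · obtain ⟨R, hR⟩ : ∃ R, ∀ i < N, r i < R :=
      ⟨(Finset.range N).sup r + 1, fun i hi =>
        Nat.lt_succ_of_le (Finset.le_sup (f := r) (Finset.mem_range.2 hi))⟩
    obtain ⟨l, M, hM, hM', hl, h⟩ := hP (Function.update r i (max k R)) k
    refine ⟨(true, max k R) :: l, M, hM, hM', by simpa using hl, fun D A ρ σ hD hA hσ => ?_⟩
    refine forall_congr' fun X => imp_congr_right fun hX => ?_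
    rw [h _ _ _ _ hD hA (update_subset hσ hX _)]
    refine hN _ _ _ _ fun j hj => ?_
    by_cases hji : j = i
    · simp [hji]
    · have := hR j hj
      simpa [hji] using Function.update_of_ne (by omega) _ _

theorem ex (i : ℕ) (hP : PrenexDefinable P) :
    PrenexDefinable fun D A σ => ∃ X ⊆ D, P D A (Function.update σ i X) :=
  (hP.not.all i).not.congr fun D A σ => by simp

theorem eq (i j : ℕ) : PrenexDefinable fun _ _ σ => σ i = σ j := by
  refine ⟨max i j + 1, fun D A σ σ' h => by simp only [h i (by omega), h j (by omega)], fun r k =>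
    ⟨[], .fall 0 (.or (.and (.Mem 0 (r i)) (.Mem 0 (r j)))
      (.and (.not (.Mem 0 (r i))) (.not (.Mem 0 (r j))))), by simp [SOF.NoSOQ],
      by simp [SOF.foFree], by simp, fun D A ρ σ hD hA hσ => ?_⟩⟩
  simp only [SOF.quantified, SOF.Eval, Function.update_self, Function.comp_apply,
    ← iff_iff_and_or_not_and_not]
  exact ⟨fun h => Set.ext fun x => ⟨fun hx => (h x (hσ _ hx)).1 hx, fun hx => (h x (hσ _ hx)).2 hx⟩,
    fun h x _ => by rw [h]⟩

theorem eq_const (i : ℕ) : PrenexDefinable fun _ A σ => σ i = A := by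
  refine ⟨i + 1, fun D A σ σ' h => by simp only [h i (by omega)], fun r k =>
    ⟨[], .fall 0 (.or (.and (.Mem 0 (r i)) (.inA 0))
      (.and (.not (.Mem 0 (r i))) (.not (.inA 0)))), by simp [SOF.NoSOQ],
      by simp [SOF.foFree], by simp, fun D A ρ σ hD hA hσ => ?_⟩⟩
  simp only [SOF.quantified, SOF.Eval, Function.update_self, Function.comp_apply,
    ← iff_iff_and_or_not_and_not]
  exact ⟨fun h => Set.ext fun x => ⟨fun hx => (h x (hσ _ hx)).1 hx, fun hx => (h x (hA hx)).2 hx⟩,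
    fun h x _ => by rw [h]⟩

theorem classMem (i j : ℕ) : PrenexDefinable fun _ _ σ => ClassMem (σ i) (σ j) := by
  refine ⟨max i j + 1, fun D A σ σ' h => by simp only [h i (by omega), h j (by omega)], fun r k =>
    ⟨[], .fex 0 (.and (.Mem 0 (r j)) (.fall 1 (.or (.and (.mem 1 0) (.Mem 1 (r i)))
      (.and (.not (.mem 1 0)) (.not (.Mem 1 (r i))))))), by simp [SOF.NoSOQ],
      by simp [SOF.foFree], by simp, fun D A ρ σ hD hA hσ => ?_⟩⟩
  simp only [SOF.quantified, SOF.Eval, Function.update_self, Function.comp_apply, ne_eq,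
    zero_ne_one, not_false_eq_true, Function.update_of_ne, ← iff_iff_and_or_not_and_not]
  refine ⟨fun ⟨x, hx, hx', h⟩ => ⟨x, hx', Set.ext fun z =>
    ⟨fun hz => (h z (hD x hx hz)).1 hz, fun hz => (h z (hσ _ hz)).2 hz⟩⟩,
    fun ⟨x, hx, h⟩ => ⟨x, hσ _ hx, hx, fun z _ => by rw [← h, SetLike.mem_coe]⟩⟩

theorem eval (φ : FOF) : PrenexDefinable fun D _ σ => φ.Eval ClassMem (· ⊆ D) σ := by
  induction φ with
  | eq i j => exact eq i j
  | mem i j => exact classMem i j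
  | not φ ih => exact ih.not
  | and φ ψ ih ih' => exact ih.and ih'
  | or φ ψ ih ih' =>
    exact (ih.not.and ih'.not).not.congr fun D A σ => by simp [FOF.Eval, or_iff_not_imp_left]
  | all i φ ih => exact ih.all i
  | ex i φ ih => exact ih.ex i

end PrenexDefinable

/-- A first-order formula about the subsets of `D` with one free variable is equivalent to a
`Π¹ₙ` sentence over `D` for some `n`. -/
theorem FOF.exists_isPiSO (φ : FOF) (hφ : φ.free ⊆ {0}) :
    ∃ n ψ, IsPiSO n ψ ∧ ψ.foFree = ∅ ∧ ψ.soFree = ∅ ∧ ∀ (D A : Set ZFSet) (ρ : ℕ → ZFSet)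
      (σ : ℕ → Set ZFSet), (∀ x ∈ D, (x : Set ZFSet) ⊆ D) → A ⊆ D →
        (ψ.Eval D A ρ σ ↔ φ.Eval ClassMem (· ⊆ D) fun _ => A) := by
  obtain ⟨N, -, h⟩ := ((PrenexDefinable.eq_const 0).and (PrenexDefinable.eval φ)).ex 0
  obtain ⟨l, M, hM, hM', -, h⟩ := h id 0
  obtain ⟨B, hB⟩ := (SOF.quantified l M).exists_soFree_lt
  let l' : List (Bool × ℕ) := (List.range B).map (true, ·)
  have hl : (SOF.quantified (l' ++ l) M).soFree = ∅ := by
    ext J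
    rw [SOF.quantified_append, SOF.mem_soFree_quantified]
    simp only [Set.mem_empty_iff_false, iff_false, not_and]
    exact fun hJ hJ' => hJ' (true, J) (List.mem_map.2 ⟨J, List.mem_range.2 (hB J hJ), rfl⟩) rfl
  refine ⟨_, _, (SOF.isPiSO_quantified (l' ++ l) hM).1, (SOF.foFree_quantified _ _).trans hM', hl,
    fun D A ρ σ hD hA => ?_⟩
  rw [SOF.eval_congr _ (fun _ _ => rfl) (σ' := fun _ => ∅) (by simp [hl]), SOF.quantified_append]
  refine SOF.eval_quantified_const (fun σ hσ => ?_) fun _ => Set.empty_subset _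
  rw [h D A ρ σ hD hA hσ]
  have key : φ.Eval ClassMem (· ⊆ D) (Function.update σ 0 A) ↔
      φ.Eval ClassMem (· ⊆ D) fun _ => A :=
    φ.eval_congr fun i hi => by simp [Set.mem_singleton_iff.1 (hφ hi)]
  rw [← key]
  constructor
  · rintro ⟨X, -, hX, h⟩
    simp only [Function.update_self] at hX
    simpa [hX] using h
  · exact fun h => ⟨A, hA, by simp, h⟩

end Prenex

section NaturalModels

open ZFSet

variable {α : Ordinal.{u}}

theorem coe_vonNeumann_eq_Vset (α : Ordinal.{u}) : (V_ α : Set ZFSet.{u}) = Vset α := by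
  ext x
  simp [Vset, mem_vonNeumann]

theorem coe_subset_Vset {α : Ordinal.{u}} {x : ZFSet.{u}} (hx : x ∈ Vset α) :
    (x : Set ZFSet) ⊆ Vset α :=
  fun _ hy => (rank_lt_of_mem hy).trans hx

theorem exists_coe_eq {x : ZFSet.{u}} {X : Set ZFSet.{u}} (h : X ⊆ x) :
    ∃ y : ZFSet.{u}, y ⊆ x ∧ (y : Set ZFSet) = X :=
  ⟨ZFSet.sep (· ∈ X) x, fun _ hz => (mem_sep.1 hz).1, by
    ext z
    simpa using fun hz => h hz⟩

theorem isSetB1_iff (x : {z : ZFSet.{u} // z.rank < α + 1}) :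
    IsSetB1 (fun x y : {z : ZFSet // z.rank < α + 1} => x.1 ∈ y.1) x ↔ x.1.rank < α := by
  constructor
  · rintro ⟨c, hc⟩
    exact (rank_lt_of_mem hc).trans_le (Order.lt_add_one_iff.1 c.2)
  · exact fun h => ⟨⟨V_ α, by simp⟩, mem_vonNeumann.2 h⟩

theorem FOF.eval_natural (φ : FOF) (ρ : ℕ → {z : ZFSet.{u} // z.rank < α + 1}) {u : ZFSet.{u}}
    (hu : u.rank ≤ α) {D : {z : ZFSet.{u} // z.rank < α + 1} → Prop} (hD : ∀ x, D x ↔ x.1 ⊆ u) :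
    φ.Eval (fun x y => x.1 ∈ y.1) D ρ ↔
      φ.Eval ClassMem (· ⊆ (u : Set ZFSet)) fun i => ((ρ i).1 : Set ZFSet) := by
  refine FOF.eval_map (f := fun x : {z : ZFSet.{u} // z.rank < α + 1} => (x.1 : Set ZFSet))
    (SetLike.coe_injective.comp Subtype.val_injective) (fun x y => by simp) (fun Y => ?_) φ ρ
  constructor
  · intro hY
    obtain ⟨y, hy, rfl⟩ := exists_coe_eq hY
    exact ⟨⟨y, Order.lt_add_one_iff.2 ((rank_mono hy).trans hu)⟩, (hD _).2 hy, rfl⟩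
  · rintro ⟨x, hx, rfl⟩
    exact (hD x).1 hx

theorem FOF.eval_natural_univ (φ : FOF) (ρ : ℕ → {z : ZFSet.{u} // z.rank < α + 1}) :
    φ.Eval (fun x y => x.1 ∈ y.1) (fun _ => True) ρ ↔
      φ.Eval ClassMem (· ⊆ Vset α) fun i => ((ρ i).1 : Set ZFSet) := by
  rw [← coe_vonNeumann_eq_Vset]
  exact φ.eval_natural ρ (rank_vonNeumann α).le fun x =>
    iff_of_true trivial (subset_vonNeumann.2 (Order.lt_add_one_iff.1 x.2))

theorem forall_mem_iff_subset (x u : {z : ZFSet.{u} // z.rank < α + 1}) :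
    (∀ z : {z : ZFSet.{u} // z.rank < α + 1}, z.1 ∈ x.1 → z.1 ∈ u.1) ↔ x.1 ⊆ u.1 :=
  ⟨fun h z hz => h ⟨z, (rank_lt_of_mem hz).trans x.2⟩ hz, fun h _ hz => h hz⟩

/-- In a natural model of `B₁`, second-order truth reflects to a transitive set. -/
theorem SatB1.exists_reflecting
    (h : SatB1 (fun x y : {z : ZFSet.{u} // z.rank < α + 1} => x.1 ∈ y.1)) {φ : SOF}
    (hφ : φ.foFree = ∅) (hφ' : φ.soFree = ∅) {A : Set ZFSet.{u}} (hA : A ⊆ Vset α)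
    {ρ : ℕ → ZFSet.{u}} {σ : ℕ → Set ZFSet.{u}} (hev : φ.Eval (Vset α) A ρ σ) :
    ∃ u : ZFSet.{u}, u.rank < α ∧ (∀ x ∈ u, x ⊆ u) ∧
      ∀ ρ σ, φ.Eval (u : Set ZFSet) (A ∩ u) ρ σ := by
  rw [← coe_vonNeumann_eq_Vset] at hA
  obtain ⟨a, ha, rfl⟩ := exists_coe_eq hA
  have ha' : a.rank < α + 1 := Order.lt_add_one_iff.2 (subset_vonNeumann.1 ha)
  have hfree : φ.toFOF.free ⊆ {0} := fun k hk => by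
    simpa [hφ, hφ'] using φ.free_toFOF hk
  obtain ⟨u, b, hu, htr, hb, hev'⟩ := h.2.2.2.1 φ.toFOF hfree (fun _ => ⟨a, ha'⟩) <| by
    rw [FOF.eval_natural_univ, ← SOF.eval_toFOF (fun _ => coe_subset_Vset) φ rfl]
    · exact hev
    · simp [hφ]
    · simp [hφ']
  rw [isSetB1_iff] at hu
  have htr' : ∀ x ∈ u.1, x ⊆ u.1 := fun x hx z hz =>
    htr ⟨x, (rank_lt_of_mem hx).trans u.2⟩ hx
      ⟨z, ((rank_lt_of_mem hz).trans (rank_lt_of_mem hx)).trans u.2⟩ hz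
  refine ⟨u, hu, htr', fun ρ σ => ?_⟩
  rw [FOF.eval_natural _ _ hu.le fun x => forall_mem_iff_subset x u] at hev'
  refine (SOF.eval_toFOF htr' φ ?_ (by simp [hφ]) (by simp [hφ'])).2 hev'
  ext z
  simp only [Function.update_self, SetLike.mem_coe, Set.mem_inter_iff]
  exact ⟨fun hz => (hb ⟨z, (rank_lt_of_mem hz).trans b.2⟩).1 hz,
    fun hz => (hb ⟨z, (rank_lt_of_mem hz.1).trans ha'⟩).2 hz⟩

theorem SatB1.exists_rank_lt
    (h : SatB1 (fun x y : {z : ZFSet.{u} // z.rank < α + 1} => x.1 ∈ y.1)) {β : Ordinal.{u}}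
    (hβ : β < α) : ∃ γ < α, β < γ := by
  obtain ⟨u, hu, -, hev⟩ := h.exists_reflecting (φ := .fex 0 (.inA 0)) (by simp [SOF.foFree])
    (by simp [SOF.soFree]) (A := {V_ β}) (by simpa [Vset] using hβ) (ρ := fun _ => ∅)
    (σ := fun _ => ∅) ⟨V_ β, by simpa [Vset] using hβ, by simp [SOF.Eval]⟩
  obtain ⟨x, hx, hx'⟩ := hev (fun _ => ∅) fun _ => ∅
  simp only [SOF.Eval, Function.update_self] at hx'
  obtain rfl : x = V_ β := hx'.1
  exact ⟨_, hu, by simpa using rank_lt_of_mem hx⟩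

/-- A sentence saying that some class of sets is a history of levels in which every set occurs. -/
def levelSentence : SOF :=
  .Fex 0 (.and (.fall 0 (.fex 1 (.and (.Mem 1 0) (.mem 0 1))))
    (.and
      (.fall 0 (.or (.not (.Mem 0 0)) (.fall 1 (.or (.not (.mem 1 0))
        (.fex 2 (.and (.and (.mem 2 0) (.Mem 2 0))
          (.fall 3 (.or (.not (.mem 3 1)) (.mem 3 2)))))))))
      (.fall 0 (.or (.not (.Mem 0 0)) (.fall 2 (.or (.not (.and (.mem 2 0) (.Mem 2 0)))
        (.Fall 1 (.or (.not (.fall 3 (.or (.not (.Mem 3 1)) (.mem 3 2))))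
          (.fex 1 (.and (.mem 1 0) (.fall 3 (.or (.and (.mem 3 1) (.Mem 3 1))
            (.and (.not (.mem 3 1)) (.not (.Mem 3 1)))))))))))))))

theorem eval_levelSentence {D A : Set ZFSet.{u}} {ρ : ℕ → ZFSet.{u}} {σ : ℕ → Set ZFSet.{u}} :
    levelSentence.Eval D A ρ σ ↔ ∃ H ⊆ D, (∀ x ∈ D, ∃ y ∈ D, y ∈ H ∧ x ∈ y) ∧
      (∀ x ∈ D, x ∈ H → ∀ z ∈ D, z ∈ x → ∃ c ∈ D, (c ∈ x ∧ c ∈ H) ∧ ∀ w ∈ D, w ∈ z → w ∈ c) ∧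
      ∀ x ∈ D, x ∈ H → ∀ c ∈ D, c ∈ x ∧ c ∈ H → ∀ Z ⊆ D, (∀ w ∈ D, w ∈ Z → w ∈ c) →
        ∃ z ∈ D, z ∈ x ∧ ∀ w ∈ D, (w ∈ z ↔ w ∈ Z) := by
  simp only [levelSentence, SOF.Eval, ← iff_iff_and_or_not_and_not, ← imp_iff_not_or]
  simp

theorem eval_levelSentence_Vset (h : ∀ β < α, ∃ γ < α, β < γ) (A : Set ZFSet.{u})
    (ρ : ℕ → ZFSet.{u}) (σ : ℕ → Set ZFSet.{u}) : levelSentence.Eval (Vset α) A ρ σ := by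
  rw [eval_levelSentence]
  refine ⟨(fun γ => V_ γ) '' Set.Iio α, ?_, fun x hx => ?_, ?_, ?_⟩
  · rintro _ ⟨γ, hγ, rfl⟩
    simpa [Vset] using hγ
  · obtain ⟨γ, hγ, hx⟩ := h _ hx
    exact ⟨V_ γ, by simpa [Vset] using hγ, ⟨γ, hγ, rfl⟩, mem_vonNeumann.2 hx⟩
  · rintro _ hx ⟨γ, hγ, rfl⟩ z - hz
    rw [mem_vonNeumann] at hz
    exact ⟨V_ z.rank, by simpa [Vset] using hz.trans hγ, ⟨vonNeumann_mem_of_lt hz, z.rank,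
      hz.trans hγ, rfl⟩, fun w _ hw => subset_vonNeumann_self z hw⟩
  · rintro _ hx ⟨γ, hγ, rfl⟩ _ - ⟨hc, δ, hδ, rfl⟩ Z hZ hZ'
    obtain ⟨z, hz, rfl⟩ := exists_coe_eq (x := V_ δ) fun w hw => hZ' w (hZ hw) hw
    have hz' : z ∈ V_ γ := mem_vonNeumann_of_subset hz hc
    exact ⟨z, (mem_vonNeumann.1 hz').trans hγ, hz', fun w _ => Iff.rfl⟩

theorem exists_eq_vonNeumann {u : ZFSet.{u}} (hu : ∀ x ∈ u, x ⊆ u) {A : Set ZFSet.{u}}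
    {ρ : ℕ → ZFSet.{u}} {σ : ℕ → Set ZFSet.{u}} (h : levelSentence.Eval u A ρ σ) :
    ∃ β, u = V_ β := by
  obtain ⟨H, hH, hcov, hsub, hsup⟩ := eval_levelSentence.1 h
  have level (x : ZFSet.{u}) : x ∈ H → x = V_ x.rank := by
    induction x using ZFSet.inductionOn with
    | h x ih =>
    intro hx
    refine ZFSet.ext fun z => ⟨fun hz => subset_vonNeumann_self x hz, fun hz => ?_⟩
    obtain ⟨y, hy, hzy⟩ := lt_rank_iff.1 (mem_vonNeumann.1 hz)
    have hyu := hu x (hH hx) hy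
    obtain ⟨c, hc, ⟨hcx, hcH⟩, hyc⟩ := hsub x (hH hx) hx y hyu hy
    have hzc : z ⊆ c := by
      rw [ih c hcx hcH, subset_vonNeumann]
      exact hzy.trans (rank_mono fun w hw => hyc w (hu y hyu hw) hw)
    obtain ⟨z', -, hz'x, hz'⟩ := hsup x (hH hx) hx c hc ⟨hcx, hcH⟩ z
      (fun w hw => hu c hc (hzc hw)) fun w _ hw => hzc hw
    have : z' = z := ZFSet.ext fun w => ⟨fun hw => (hz' w (hu z' (hu x (hH hx) hz'x) hw)).1 hw,
      fun hw => (hz' w (hu c hc (hzc hw))).2 hw⟩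
    exact this ▸ hz'x
  refine ⟨u.rank, ZFSet.ext fun z => ⟨fun hz => subset_vonNeumann_self u hz, fun hz => ?_⟩⟩
  obtain ⟨y, hy, hzy⟩ := lt_rank_iff.1 (mem_vonNeumann.1 hz)
  obtain ⟨v, hv, hvH, hyv⟩ := hcov y hy
  refine hu v hv ?_
  rw [level v hvH, mem_vonNeumann]
  exact hzy.trans_lt (rank_lt_of_mem hyv)

theorem SatB1.piIndescribable
    (h : SatB1 (fun x y : {z : ZFSet.{u} // z.rank < α + 1} => x.1 ∈ y.1)) (n : ℕ) :
    PiIndescribable n α := by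
  intro φ _ hφ hφ' A hA hev
  have hlev : levelSentence.foFree = ∅ ∧ levelSentence.soFree = ∅ := by
    constructor <;> ext k
    · simp [levelSentence, SOF.foFree]
      omega
    · simp [levelSentence, SOF.soFree]
  obtain ⟨u, hu, htr, hev'⟩ := h.exists_reflecting (φ := φ.and levelSentence)
    (by simp [SOF.foFree, hφ, hlev.1]) (by simp [SOF.soFree, hφ', hlev.2]) hA
    ⟨hev (fun _ => ∅) fun _ => ∅, eval_levelSentence_Vset (fun _ => h.exists_rank_lt) _ _ _⟩
  obtain ⟨β, rfl⟩ := exists_eq_vonNeumann htr (hev' (fun _ => ∅) fun _ => ∅).2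
  rw [rank_vonNeumann] at hu
  refine ⟨β, hu, fun ρ σ => ?_⟩
  rw [← coe_vonNeumann_eq_Vset]
  exact (hev' ρ σ).1

/-- In a natural model of `B₁`, a function on a set has bounded values. -/
theorem SatB1.exists_bound
    (h : SatB1 (fun x y : {z : ZFSet.{u} // z.rank < α + 1} => x.1 ∈ y.1)) {g : ZFSet.{u}}
    (hg : g.rank < α) {f : ZFSet.{u} → ZFSet.{u}} (hf : ∀ x ∈ g, (f x).rank < α) :
    ∃ γ < α, ∀ x ∈ g, (f x).rank < γ := by
  have succ_lt {β : Ordinal.{u}} (hβ : β < α) : Order.succ β < α := by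
    obtain ⟨γ, hγ, hβ⟩ := h.exists_rank_lt hβ
    exact (Order.succ_le_of_lt hβ).trans_lt hγ
  let p (x : ZFSet.{u}) : ZFSet.{u} := {g, x, {g, f x}}
  have hgp (x) : g ∈ p x := by simp [p]
  have hp {x} (hx : x ∈ g) : (p x).rank < α := by
    simp only [p, rank_insert, rank_singleton, max_lt_iff]
    exact ⟨succ_lt hg, succ_lt ((rank_lt_of_mem hx).trans hg), succ_lt (max_lt (succ_lt hg)
      (succ_lt (hf x hx)))⟩
  have mem_p {x y} (hx : x ∈ g) (h : x ∈ p y) : x = y := by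
    simp only [p, ZFSet.mem_insert_iff, ZFSet.mem_singleton] at h
    rcases h with rfl | rfl | rfl
    · exact (mem_irrefl _ hx).elim
    · rfl
    · exact (mem_asymm hx (by simp)).elim
  let φ : SOF := .fex 0 (.and (.inA 0)
    (.and (.fall 1 (.or (.not (.inA 1)) (.or (.eq 1 0) (.mem 0 1))))
      (.fall 1 (.or (.not (.mem 1 0)) (.fex 2 (.and (.inA 2) (.and (.mem 0 2) (.mem 1 2))))))))
  have hφ (D A : Set ZFSet.{u}) (ρ σ) : φ.Eval D A ρ σ ↔ ∃ a ∈ D, a ∈ A ∧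
      (∀ y ∈ D, y ∈ A → y = a ∨ a ∈ y) ∧ ∀ x ∈ D, x ∈ a → ∃ y ∈ D, y ∈ A ∧ a ∈ y ∧ x ∈ y := by
    simp [φ, SOF.Eval, ← imp_iff_not_or]
  obtain ⟨u, hu, htr, hev⟩ := h.exists_reflecting (φ := φ) (A := insert g (p '' g))
    (by ext k; simp [φ, SOF.foFree]; omega) (by simp [φ, SOF.soFree])
    (by
      rintro _ (rfl | ⟨x, hx, rfl⟩)
      · exact hg
      · exact hp hx) (ρ := fun _ => ∅) (σ := fun _ => ∅) <| by
    rw [hφ]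
    refine ⟨g, hg, Or.inl rfl, ?_, fun x _ hx => ⟨p x, hp hx, Or.inr ⟨x, hx, rfl⟩, hgp x,
      by simp [p]⟩⟩
    rintro _ - (rfl | ⟨x, -, rfl⟩)
    · exact Or.inl rfl
    · exact Or.inr (hgp x)
  obtain ⟨a, -, ⟨ha, hau⟩, hmin, hall⟩ := (hφ ..).1 (hev (fun _ => ∅) fun _ => ∅)
  obtain rfl : a = g := by
    obtain rfl | ⟨x, -, rfl⟩ := ha
    · rfl
    · have hgu : g ∈ u := htr _ hau (hgp x)
      rcases hmin g hgu ⟨Or.inl rfl, hgu⟩ with h | h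
      · exact h.symm
      · exact (mem_asymm h (hgp x)).elim
  refine ⟨u.rank, hu, fun x hx => ?_⟩
  obtain ⟨y, hy, ⟨hyA, -⟩, hay, hxy⟩ := hall x (htr _ hau hx) hx
  obtain rfl | ⟨z, -, rfl⟩ := hyA
  · exact (mem_irrefl _ hay).elim
  · obtain rfl := mem_p hx hxy
    have h₁ : ({a, f x} : ZFSet.{u}) ∈ p x := by simp [p]
    have h₂ : f x ∈ ({a, f x} : ZFSet.{u}) := by simp
    exact rank_lt_of_mem (htr _ (htr _ hy h₁) h₂)

theorem SatB1.exists_ord_eq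
    (h : SatB1 (fun x y : {z : ZFSet.{u} // z.rank < α + 1} => x.1 ∈ y.1)) :
    ∃ c : Cardinal.{u}, c.ord = α := by
  refine ⟨α.card, (Cardinal.ord_le.2 le_rfl).antisymm (le_of_not_gt fun hlt => ?_)⟩
  obtain ⟨e⟩ : Nonempty (Set.Iio α.card.ord ≃ Set.Iio α) := by
    rw [← Cardinal.eq, Cardinal.mk_Iio_ordinal, Cardinal.mk_Iio_ordinal, Cardinal.card_ord]
  let f (x : ZFSet.{u}) : ZFSet.{u} :=
    if hx : x.rank < α.card.ord then (e ⟨x.rank, hx⟩).1.toZFSet else ∅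
  obtain ⟨γ, hγ, hb⟩ := h.exists_bound (g := α.card.ord.toZFSet) (f := f) (by simpa using hlt)
    fun x hx => by
      have hx' : x.rank < α.card.ord := by simpa using rank_lt_of_mem hx
      simp only [f, hx', dite_true, Ordinal.rank_toZFSet]
      exact (e ⟨x.rank, hx'⟩).2
  let x := (e.symm ⟨γ, hγ⟩).1
  have hx : x < α.card.ord := (e.symm ⟨γ, hγ⟩).2
  have := hb x.toZFSet (Ordinal.toZFSet_mem_toZFSet_iff.2 hx)
  simp [f, hx, x] at this

theorem satB1_of_piIndescribable (h : ∀ n : ℕ, PiIndescribable n α) :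
    SatB1 (fun x y : {z : ZFSet.{u} // z.rank < α + 1} => x.1 ∈ y.1) := by
  have sep (P : ZFSet.{u} → Prop) : ∃ A : {z : ZFSet.{u} // z.rank < α + 1},
      ∀ x : ZFSet.{u}, x ∈ A.1 ↔ P x ∧ x.rank < α :=
    ⟨⟨ZFSet.sep P (V_ α), Order.lt_add_one_iff.2 (subset_vonNeumann.1 fun _ hz =>
      (mem_sep.1 hz).1)⟩, fun x => by simp [mem_vonNeumann, and_comm]⟩
  have rank_lt {x : ZFSet.{u}} {y : {z : ZFSet.{u} // z.rank < α + 1}} (hx : x ∈ y.1) :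
      x.rank < α :=
    (rank_lt_of_mem hx).trans_le (Order.lt_add_one_iff.1 y.2)
  have lift {x : ZFSet.{u}} (hx : x.rank < α) : x.rank < α + 1 :=
    hx.trans (Order.lt_add_one_iff.2 le_rfl)
  refine ⟨fun A B hAB => ?_, fun φ ρ => ?_, fun A B hA hBA => ?_, fun φ hφ ρ hev => ?_,
    fun A hA => ?_, fun x hx hdisj => ?_⟩
  · exact Subtype.ext (ZFSet.ext fun z => ⟨fun hz => (hAB ⟨z, lift (rank_lt hz)⟩).1 hz,
      fun hz => (hAB ⟨z, lift (rank_lt hz)⟩).2 hz⟩)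
  · obtain ⟨A, hA⟩ := sep fun z => ∃ hz : z.rank < α + 1,
      FOF.Eval (fun x y : {z : ZFSet.{u} // z.rank < α + 1} => x.1 ∈ y.1) (fun _ => True) φ
        (Function.update ρ 0 ⟨z, hz⟩)
    refine ⟨A, fun x => ?_⟩
    rw [isSetB1_iff]
    refine (hA x.1).trans ?_
    exact and_congr_left fun _ => ⟨fun h => h.2, fun h => ⟨x.2, h⟩⟩
  · rw [isSetB1_iff] at hA ⊢
    exact (rank_mono ((forall_mem_iff_subset B A).1 hBA)).trans_lt hA
  · obtain ⟨n, ψ, hψ, hψ', hψ'', hψφ⟩ := φ.exists_isPiSO hφ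
    have hA : ((ρ 0).1 : Set ZFSet) ⊆ Vset α := fun z hz => rank_lt hz
    have hcongr (D A : Set ZFSet.{u}) (τ : ℕ → Set ZFSet.{u}) (hτ : τ 0 = A) :
        φ.Eval ClassMem (· ⊆ D) τ ↔ φ.Eval ClassMem (· ⊆ D) fun _ => A :=
      φ.eval_congr fun i hi => by simp [Set.mem_singleton_iff.1 (hφ hi), hτ]
    rw [FOF.eval_natural_univ, hcongr _ _ _ rfl] at hev
    obtain ⟨β, hβ, hev'⟩ := h n ψ hψ hψ' hψ'' _ hA fun ρ σ =>
      (hψφ _ _ ρ σ (fun _ => coe_subset_Vset) hA).2 hev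
    obtain ⟨b, hb⟩ := sep fun z => z ∈ (ρ 0).1 ∧ z ∈ V_ β
    have hVβ : (V_ β).rank < α := by simpa using hβ
    refine ⟨⟨V_ β, lift hVβ⟩, b, (isSetB1_iff _).2 hVβ, fun y hy z hz =>
      (isTransitive_vonNeumann β).subset_of_mem hy hz,
      fun z => (hb z).trans (and_iff_left_of_imp fun hz => rank_lt hz.1), ?_⟩
    rw [FOF.eval_natural φ _ hVβ.le fun x => forall_mem_iff_subset x ⟨V_ β, lift hVβ⟩,
      coe_vonNeumann_eq_Vset]
    refine (hcongr _ ((ρ 0).1 ∩ Vset β) _ ?_).2 ((hψφ _ _ (fun _ => ∅) (fun _ => ∅)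
      (fun _ => coe_subset_Vset) Set.inter_subset_right).1 (hev' _ _))
    ext z
    simp only [Function.update_self, SetLike.mem_coe, hb, Set.mem_inter_iff, mem_vonNeumann, Vset,
      Set.mem_ofPred_eq]
    exact and_iff_left_of_imp fun hz => rank_lt hz.1
  · obtain ⟨x, hx⟩ := hA
    obtain ⟨y, hy, hyA⟩ := regularity A.1 fun h => notMem_empty x.1 (h ▸ hx)
    refine ⟨⟨y, lift (rank_lt hy)⟩, hy, fun z hz => notMem_empty z.1 ?_⟩
    rw [← hyA]
    exact mem_inter.2 ⟨hz.2, hz.1⟩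
  · classical
    let c (y : ZFSet.{u}) : ZFSet.{u} := if hy : ∃ z, z ∈ y then hy.choose else ∅
    have hc {y z : ZFSet.{u}} (hz : z ∈ y) : c y ∈ y := by
      have hy : ∃ z, z ∈ y := ⟨z, hz⟩
      simpa [c, hy] using hy.choose_spec
    obtain ⟨x', hx'⟩ := sep fun z => ∃ y ∈ x.1, z ∈ y ∧ z = c y
    refine ⟨x', fun y hy ⟨z, hz⟩ => ⟨⟨c y, lift (rank_lt (hc hz))⟩,
      ⟨hc hz, (hx' _).2 ⟨⟨y, hy, hc hz, rfl⟩, rank_lt (hc hz)⟩⟩, ?_⟩⟩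
    rintro ⟨w, hw⟩ ⟨hwy, hwx'⟩
    obtain ⟨⟨y', hy', hwy', rfl⟩, -⟩ := (hx' _).1 hwx'
    by_cases hyy' : y.1 = y'
    · subst hyy'
      rfl
    · exact (hdisj y ⟨y', lift (rank_lt hy')⟩ hy hy' (fun h => hyy' (congrArg Subtype.val h))
        ⟨⟨c y', hw⟩, hwy, hwy'⟩).elim

end NaturalModels

/- STATEMENT 6.  For every ordinal `α`, the structure `(V_{α+1}, ∈)` is a (natural) model
of Bernays' theory `B₁` if and only if `α` is a `Π¹_∞`-indescribable cardinal. -/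
theorem statement6 (α : Ordinal) :
    SatB1 (fun x y : {z : ZFSet // z.rank < α + 1} => x.1 ∈ y.1) ↔
      ((∃ c : Cardinal, c.ord = α) ∧ ∀ n : ℕ, PiIndescribable n α) := by
  exact ⟨fun h => ⟨h.exists_ord_eq, h.piIndescribable⟩, fun h => satB1_of_piIndescribable h.2⟩
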